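/- Let G = (V, E) be a finite simple graph on n vertices with n even, with edge weights w: E → ℝ, let C ⊆ V be a vertex cover of G, and let X ⊆ C be such that |X| ≤ n/2 and n/2 - |X| ≤ |V \ C|. Then the maximum of w(A, B) over all bisections (A, B) of G with A ∩ C = X equals w(X, C \ X) + Σ_{v ∈ V \ C} w(X, {v}) + max { Σ_{v ∈ S} p_v : S ⊆ V \ C, |S| = n/2 - |X| }, where p_v = w(C \ X, {v}) - w(X, {v}) for each v ∈ V \ C. -/

import Mathlib

/-- For disjoint sets `Y, Z` of vertices of the edge-weighted graph `G`, `wSum G w Y Z`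
is the total weight of the edges of `G` with one endpoint in `Y` and one endpoint in `Z`
(each such edge is counted once, as the ordered pair whose first coordinate lies in `Y`). -/
def wSum {V : Type*} [Fintype V] [DecidableEq V] (G : SimpleGraph V) [DecidableRel G.Adj]
    (w : Sym2 V → ℝ) (Y Z : Finset V) : ℝ :=
  ∑ p ∈ Finset.univ.filter (fun p : V × V => G.Adj p.1 p.2 ∧ p.1 ∈ Y ∧ p.2 ∈ Z),
    w s(p.1, p.2)

/-- `(A, Aᶜ)` is a bisection: the two sides differ in size by at most one. -/
def IsBisection {V : Type*} [Fintype V] [DecidableEq V] (A : Finset V) : Prop :=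
  -1 ≤ (A.card : ℤ) - (Aᶜ.card : ℤ) ∧ (A.card : ℤ) - (Aᶜ.card : ℤ) ≤ 1

section wSum

variable {V : Type*} [Fintype V] [DecidableEq V] (G : SimpleGraph V) [DecidableRel G.Adj]
  (w : Sym2 V → ℝ)

lemma wSum_eq_sum_sum (Y Z : Finset V) :
    wSum G w Y Z = ∑ y ∈ Y, ∑ z ∈ Z, if G.Adj y z then w s(y, z) else 0 := by
  rw [wSum, ← Finset.sum_product', ← Finset.sum_filter]
  refine Finset.sum_congr ?_ fun _ _ => rfl
  ext p
  simp only [Finset.mem_filter, Finset.mem_univ, true_and, Finset.mem_product]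
  tauto

lemma wSum_comm (Y Z : Finset V) : wSum G w Y Z = wSum G w Z Y := by
  rw [wSum_eq_sum_sum, wSum_eq_sum_sum, Finset.sum_comm]
  simp only [G.adj_comm, Sym2.eq_swap]

lemma wSum_eq_sum_singleton (Y Z : Finset V) : wSum G w Y Z = ∑ z ∈ Z, wSum G w Y {z} := by
  simp only [wSum_eq_sum_sum, Finset.sum_singleton]
  exact Finset.sum_comm

lemma wSum_union_right (Y : Finset V) {Z Z' : Finset V} (h : Disjoint Z Z') :
    wSum G w Y (Z ∪ Z') = wSum G w Y Z + wSum G w Y Z' := by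
  rw [wSum_eq_sum_singleton, Finset.sum_union h, ← wSum_eq_sum_singleton,
    ← wSum_eq_sum_singleton]

lemma wSum_union_left {Y Y' : Finset V} (Z : Finset V) (h : Disjoint Y Y') :
    wSum G w (Y ∪ Y') Z = wSum G w Y Z + wSum G w Y' Z := by
  rw [wSum_comm, wSum_union_right G w Z h, wSum_comm G w Z, wSum_comm G w Z]

lemma wSum_eq_zero_of_not_adj {Y Z : Finset V} (h : ∀ y ∈ Y, ∀ z ∈ Z, ¬G.Adj y z) :
    wSum G w Y Z = 0 := by
  rw [wSum_eq_sum_sum]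
  exact Finset.sum_eq_zero fun y hy => Finset.sum_eq_zero fun z hz => if_neg (h y hy z hz)

/-- The size of the cut determined by `X ∪ S`, where `X` lies in a vertex cover `C` and `S`
outside of it. -/
lemma wSum_union_compl_of_vertexCover {C X S : Finset V}
    (hC : ∀ ⦃u v : V⦄, G.Adj u v → u ∈ C ∨ v ∈ C) (hX : X ⊆ C) (hS : S ⊆ Cᶜ) :
    wSum G w (X ∪ S) (X ∪ S)ᶜ = wSum G w X (C \ X) + (∑ v ∈ Cᶜ, wSum G w X {v}) +
      ∑ v ∈ S, (wSum G w (C \ X) {v} - wSum G w X {v}) := by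
  have hcompl : (X ∪ S)ᶜ = (C \ X) ∪ (Cᶜ \ S) := by
    ext v
    have := @hX v
    have := @hS v
    simp only [Finset.mem_compl, Finset.mem_union, Finset.mem_sdiff] at *
    tauto
  have hdisj : Disjoint (C \ X) (Cᶜ \ S) :=
    disjoint_compl_right.mono Finset.sdiff_subset Finset.sdiff_subset
  have hXS : Disjoint X S := disjoint_compl_right.mono hX hS
  have hzero : wSum G w S (Cᶜ \ S) = 0 := by
    refine wSum_eq_zero_of_not_adj G w fun y hy z hz hyz => ?_
    have hy' := Finset.mem_compl.mp (hS hy)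
    have hz' := Finset.mem_compl.mp (Finset.mem_sdiff.mp hz).1
    exact (hC hyz).elim hy' hz'
  have hsplit := Finset.sum_sdiff (f := fun v => wSum G w X {v}) hS
  rw [hcompl, wSum_union_left G w _ hXS, wSum_union_right G w _ hdisj,
    wSum_union_right G w _ hdisj, hzero, wSum_comm G w S, wSum_eq_sum_singleton G w X (Cᶜ \ S),
    wSum_eq_sum_singleton G w (C \ X) S, Finset.sum_sub_distrib]
  linarith

end wSum

lemma isBisection_iff_card_eq {V : Type*} [Fintype V] [DecidableEq V]
    (hn : Even (Fintype.card V)) (A : Finset V) :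
    IsBisection A ↔ A.card = Fintype.card V / 2 := by
  have := Finset.card_add_card_compl A
  obtain ⟨k, hk⟩ := hn
  unfold IsBisection
  omega

/-- Let `G` be an edge-weighted graph on an even number `n` of vertices, let `C` be a
vertex cover of `G`, and let `X ⊆ C` with `|X| ≤ n/2` and `n/2 - |X| ≤ |V \ C|`.
The maximum of `w(A, Aᶜ)` over all bisections `(A, Aᶜ)` of `G` with `A ∩ C = X` equals
`w(X, C \ X) + ∑_{v ∉ C} w(X, {v}) + max { ∑_{v ∈ S} p_v : S ⊆ V \ C, |S| = n/2 - |X| }`,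
where `p_v = w(C \ X, {v}) - w(X, {v})`. -/
theorem max_bisection_given_vertex_cover_side
    {V : Type*} [Fintype V] [DecidableEq V] (G : SimpleGraph V) [DecidableRel G.Adj]
    (w : Sym2 V → ℝ) (n : ℕ) (hcard : Fintype.card V = n) (hn : Even n)
    (C : Finset V) (hC : ∀ ⦃u v : V⦄, G.Adj u v → u ∈ C ∨ v ∈ C)
    (X : Finset V) (hX : X ⊆ C)
    (hX1 : X.card ≤ n / 2) (hX2 : n / 2 - X.card ≤ Cᶜ.card) :
    IsGreatest {s : ℝ | ∃ A : Finset V, A ∩ C = X ∧ IsBisection A ∧ s = wSum G w A Aᶜ}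
      (wSum G w X (C \ X) + (∑ v ∈ Cᶜ, wSum G w X {v}) +
        (Cᶜ.powersetCard (n / 2 - X.card)).sup'
          (Finset.powersetCard_nonempty.mpr hX2)
          (fun S => ∑ v ∈ S, (wSum G w (C \ X) {v} - wSum G w X {v}))) := by
  subst hcard
  constructor
  · obtain ⟨S, hS, hmax⟩ := Finset.exists_mem_eq_sup' (Finset.powersetCard_nonempty.mpr hX2)
      (fun S => ∑ v ∈ S, (wSum G w (C \ X) {v} - wSum G w X {v}))
    obtain ⟨hSC, hScard⟩ := Finset.mem_powersetCard.mp hS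
    have hXS : Disjoint X S := disjoint_compl_right.mono hX hSC
    refine ⟨X ∪ S, ?_, ?_, ?_⟩
    · rw [Finset.union_inter_distrib_right, Finset.inter_eq_left.mpr hX,
        Finset.disjoint_iff_inter_eq_empty.mp (disjoint_compl_left.mono_left hSC),
        Finset.union_empty]
    · rw [isBisection_iff_card_eq hn, Finset.card_union_of_disjoint hXS]
      omega
    · rw [hmax, wSum_union_compl_of_vertexCover G w hC hX hSC]
  · rintro _ ⟨A, rfl, hA, rfl⟩
    rw [isBisection_iff_card_eq hn] at hA
    have hSC : A \ C ⊆ Cᶜ := fun v hv => Finset.mem_compl.mpr (Finset.mem_sdiff.mp hv).2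
    have hunion : A ∩ C ∪ A \ C = A := sup_inf_sdiff A C
    have hcardA := Finset.card_inter_add_card_sdiff A C
    have hcut := wSum_union_compl_of_vertexCover G w hC hX hSC
    rw [hunion] at hcut
    rw [hcut]
    gcongr
    exact Finset.le_sup' (fun S => ∑ v ∈ S, (wSum G w (C \ (A ∩ C)) {v} - wSum G w (A ∩ C) {v}))
      (Finset.mem_powersetCard.mpr ⟨hSC, by omega⟩)
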